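/- Let {x(k); k ∈ ℤ₊} be nonnegative 1×M row vectors given by x(k) = x(0) (R₀ * F)(k) for k ≥ 1, where F(k) = Σ_{n=0}^{∞} R^{*n}(k) and {R₀(k)}, {R(k)} are nonnegative matrix sequences with R := Σ_k R(k) satisfying sp(R) < 1. Suppose for some ℤ₊-valued subexponential random variable Y: lim_k R̄₀(k)/P(Y>k) = C_{R₀} and lim_k R̄(k)/P(Y>k) = C_R entrywise (R̄ denotes tail sums). Then lim_{k→∞} x̄(k)/P(Y>k) = x(0)[C_{R₀}(I−R)^{−1} + R₀(I−R)^{−1} C_R (I−R)^{−1}], where x̄(k) = Σ_{l=k+1}^{∞} x(l) and R₀ = Σ_k R₀(k). -/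

import Mathlib

open Filter Topology

/-- `P(Y > k)` for a ℤ₊-valued random variable with pmf `p`. -/
noncomputable def tail (p : ℕ → ℝ) (k : ℕ) : ℝ := ∑' l : ℕ, p (k + 1 + l)

/-- Discrete convolution of two pmfs on ℤ₊. -/
noncomputable def conv (f g : ℕ → ℝ) (k : ℕ) : ℝ :=
  ∑ l ∈ Finset.range (k + 1), f (k - l) * g l

/-- Convolution of two matrix sequences. -/
noncomputable def mconv {d0 d1 d2 : ℕ} (P : ℕ → Matrix (Fin d0) (Fin d1) ℝ)
    (Q : ℕ → Matrix (Fin d1) (Fin d2) ℝ) (k : ℕ) : Matrix (Fin d0) (Fin d2) ℝ :=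
  ∑ l ∈ Finset.range (k + 1), P (k - l) * Q l

/-- `n`-fold convolution of a square-matrix sequence with itself. -/
noncomputable def mconvPow {M : ℕ} (R : ℕ → Matrix (Fin M) (Fin M) ℝ) :
    ℕ → ℕ → Matrix (Fin M) (Fin M) ℝ
  | 0 => fun k => if k = 0 then 1 else 0
  | n + 1 => fun k => ∑ l ∈ Finset.range (k + 1), mconvPow R n (k - l) * R l

/-! ### Tails and convolutions of real sequences -/

theorem tsum_eq_add_tail {f : ℕ → ℝ} (hf : Summable f) : ∑' k, f k = f 0 + tail f 0 := by
  rw [hf.tsum_eq_zero_add]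
  simp only [tail, zero_add, add_comm]

theorem tail_eq_add_tail_succ {f : ℕ → ℝ} (hf : Summable f) (k : ℕ) :
    tail f k = f (k + 1) + tail f (k + 1) := by
  have hs : Summable fun l => f (k + 1 + l) := by
    simpa only [add_comm] using (summable_nat_add_iff (k + 1)).2 hf
  rw [tail, hs.tsum_eq_zero_add, tail]
  congr 1
  exact tsum_congr fun l => by congr 1; omega

theorem tail_antitone {f : ℕ → ℝ} (hnn : ∀ k, 0 ≤ f k) (hf : Summable f) : Antitone (tail f) :=
  antitone_nat_of_succ_le fun k => by linarith [tail_eq_add_tail_succ hf k, hnn (k + 1)]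

theorem tail_sum {ι : Type*} (s : Finset ι) {f : ι → ℕ → ℝ} (hf : ∀ i ∈ s, Summable (f i)) (k : ℕ) :
    tail (fun n => ∑ i ∈ s, f i n) k = ∑ i ∈ s, tail (f i) k := by
  unfold tail
  refine Summable.tsum_finsetSum fun i hi => ?_
  simpa only [add_comm] using (summable_nat_add_iff (k + 1)).2 (hf i hi)

theorem tail_const_mul (c : ℝ) (f : ℕ → ℝ) (k : ℕ) :
    tail (fun n => c * f n) k = c * tail f k :=
  tsum_mul_left

theorem conv_comm (f g : ℕ → ℝ) (k : ℕ) : conv f g k = conv g f k := by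
  unfold conv
  rw [← Finset.sum_range_reflect]
  refine Finset.sum_congr rfl fun l hl => ?_
  have hl := Finset.mem_range.1 hl
  rw [show k - (k + 1 - 1 - l) = l by omega, show k + 1 - 1 - l = k - l by omega, mul_comm]

theorem hasSum_conv {f g : ℕ → ℝ} (hf : Summable f) (hg : Summable g) :
    HasSum (conv f g) ((∑' k, f k) * ∑' k, g k) := by
  have h := hasSum_sum_range_mul_of_summable_norm hg.norm hf.norm
  rw [mul_comm]
  convert! h using 1
  ext k
  exact Finset.sum_congr rfl fun l _ => mul_comm _ _

/-- The tail of a convolution. -/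
theorem tail_conv {f g : ℕ → ℝ} (hf : Summable f) (hg : Summable g) (k : ℕ) :
    tail (conv f g) k = conv (tail f) g k + (∑' n, f n) * tail g k := by
  have hfg := hasSum_conv hf hg
  induction k with
  | zero =>
    have h := tsum_eq_add_tail hfg.summable
    rw [hfg.tsum_eq, tsum_eq_add_tail hg] at h
    have hF := tsum_eq_add_tail hf
    simp only [conv, zero_add, Finset.sum_range_one, Nat.sub_self] at h ⊢
    linear_combination g 0 * hF - h
  | succ k ih =>
    have h := tail_eq_add_tail_succ hfg.summable k
    have hF := tsum_eq_add_tail hf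
    have hg' := tail_eq_add_tail_succ hg k
    have hs : conv (tail f) g k = ∑ l ∈ Finset.range (k + 1), f (k + 1 - l) * g l +
        ∑ l ∈ Finset.range (k + 1), tail f (k + 1 - l) * g l := by
      rw [conv, ← Finset.sum_add_distrib]
      refine Finset.sum_congr rfl fun l hl => ?_
      have hl := Finset.mem_range.1 hl
      rw [tail_eq_add_tail_succ hf, show k + 1 - l = k - l + 1 by omega]
      ring
    have h1 : conv f g (k + 1) =
        ∑ l ∈ Finset.range (k + 1), f (k + 1 - l) * g l + f 0 * g (k + 1) := by
      rw [conv, Finset.sum_range_succ, Nat.sub_self]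
    have h2 : conv (tail f) g (k + 1) =
        ∑ l ∈ Finset.range (k + 1), tail f (k + 1 - l) * g l + tail f 0 * g (k + 1) := by
      rw [conv, Finset.sum_range_succ, Nat.sub_self]
    linear_combination ih - h - h1 + hs - h2 + (∑' n, f n) * hg' + g (k + 1) * hF

theorem conv_sub (f g a : ℕ → ℝ) (k : ℕ) :
    conv (fun n => f n - g n) a k = conv f a k - conv g a k := by
  simp only [conv, sub_mul, Finset.sum_sub_distrib]

theorem conv_const_mul (c : ℝ) (f a : ℕ → ℝ) (k : ℕ) :
    conv (fun n => c * f n) a k = c * conv f a k := by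
  simp only [conv, Finset.mul_sum, mul_assoc]

theorem conv_mono {f g a : ℕ → ℝ} (ha : ∀ k, 0 ≤ a k) {k : ℕ} (h : ∀ n ≤ k, f n ≤ g n) :
    conv f a k ≤ conv g a k :=
  Finset.sum_le_sum fun l _ => mul_le_mul_of_nonneg_right (h _ (Nat.sub_le _ _)) (ha l)

theorem abs_conv_le {f a : ℕ → ℝ} (ha : ∀ k, 0 ≤ a k) (k : ℕ) :
    |conv f a k| ≤ conv (fun n => |f n|) a k := by
  refine (Finset.abs_sum_le_sum_abs _ _).trans_eq (Finset.sum_congr rfl fun l _ => ?_)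
  rw [abs_mul, abs_of_nonneg (ha l)]

/-- If the weights `a` are locally negligible with respect to `T`, then the convolution with `a`
only sees the asymptotic behaviour of `g / T`. -/
theorem tendsto_conv_div_of_tendsto_div {T g a : ℕ → ℝ} {γ A : ℝ} (hT : ∀ k, 0 < T k)
    (ha : ∀ k, 0 ≤ a k) (hloc : ∀ j, Tendsto (fun k => a k / T (k + j)) atTop (𝓝 0))
    (hTa : Tendsto (fun k => conv T a k / T k) atTop (𝓝 A))
    (hg : Tendsto (fun k => g k / T k) atTop (𝓝 γ)) :
    Tendsto (fun k => conv g a k / T k) atTop (𝓝 (γ * A)) := by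
  set h : ℕ → ℝ := fun k => g k - γ * T k with hh
  have hh0 : Tendsto (fun k => h k / T k) atTop (𝓝 0) := by
    have := hg.sub_const γ
    rw [sub_self] at this
    refine this.congr fun k => ?_
    have := (hT k).ne'
    simp only [hh]
    field_simp
  have key : Tendsto (fun k => conv h a k / T k) atTop (𝓝 0) := by
    rw [Metric.tendsto_atTop']
    intro ε hε
    obtain ⟨δ, hδ, hδA⟩ : ∃ δ > 0, δ * A < ε := by
      refine ⟨ε / (2 * (|A| + 1)), by positivity, ?_⟩
      rw [div_mul_eq_mul_div, div_lt_iff₀ (by positivity)]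
      nlinarith [le_abs_self A, abs_nonneg A]
    obtain ⟨K, hK⟩ := Filter.eventually_atTop.1 (Metric.tendsto_nhds.1 hh0 δ hδ)
    have hK' : ∀ n, |h n| ≤ δ * T n + if n < K then |h n| else 0 := by
      intro n
      split_ifs with hn
      · have := mul_pos hδ (hT n)
        linarith
      · have := hK n (not_lt.1 hn)
        rw [Real.dist_eq, sub_zero, abs_div, abs_of_pos (hT n), div_lt_iff₀ (hT n)] at this
        linarith
    have hlim : Tendsto (fun k => δ * (conv T a k / T k) +
        ∑ l ∈ Finset.range K, |h l| * (a (k - l) / T k)) atTop (𝓝 (δ * A + 0)) := by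
      refine (hTa.const_mul δ).add ?_
      rw [show (0 : ℝ) = ∑ l ∈ Finset.range K, |h l| * 0 by simp]
      refine tendsto_finsetSum _ fun l _ => Tendsto.const_mul _ ?_
      rw [← tendsto_add_atTop_iff_nat l]
      simpa using hloc l
    rw [add_zero] at hlim
    obtain ⟨N, hN⟩ := Filter.eventually_atTop.1 (hlim.eventually_lt_const hδA)
    refine ⟨max N K, fun k hk => ?_⟩
    have hkN : N ≤ k := (le_max_left _ _).trans hk.le
    have hkK : K ≤ k := (le_max_right _ _).trans hk.le
    rw [Real.dist_eq, sub_zero, abs_div, abs_of_pos (hT k)]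
    refine lt_of_le_of_lt ?_ (hN k hkN)
    rw [div_le_iff₀ (hT k), add_mul, mul_assoc, div_mul_cancel₀ _ (hT k).ne']
    have hsum : (∑ l ∈ Finset.range K, |h l| * (a (k - l) / T k)) * T k =
        conv (fun n => if n < K then |h n| else 0) a k := by
      rw [conv_comm, conv, Finset.sum_mul,
        ← Finset.sum_subset (Finset.range_subset_range.2 (by omega : K ≤ k + 1))]
      · refine Finset.sum_congr rfl fun l hl => ?_
        have := (hT k).ne'
        rw [if_pos (Finset.mem_range.1 hl)]
        field_simp
      · intro l _ hl
        rw [if_neg (by simpa using hl), mul_zero]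
    rw [hsum]
    refine (abs_conv_le ha k).trans ((conv_mono ha fun n _ => hK' n).trans_eq ?_)
    simp only [conv, add_mul, Finset.sum_add_distrib, Finset.mul_sum, mul_assoc]
  have hsum := key.add (hTa.const_mul γ)
  rw [zero_add] at hsum
  refine hsum.congr fun k => ?_
  rw [hh, conv_sub, conv_const_mul]
  ring

/-! ### Subexponential sequences -/

/-- `p` is the probability mass function of a subexponential random variable. -/
structure IsSubexponential (p : ℕ → ℝ) : Prop where
  nonneg : ∀ k, 0 ≤ p k
  hasSum : HasSum p 1
  tail_pos : ∀ k, 0 < tail p k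
  tendsto_tail_conv : Tendsto (fun k => tail (conv p p) k / tail p k) atTop (𝓝 2)

namespace IsSubexponential

variable {p : ℕ → ℝ}

theorem tendsto_conv_tail_self (hp : IsSubexponential p) :
    Tendsto (fun k => conv (tail p) p k / tail p k) atTop (𝓝 1) := by
  have h := hp.tendsto_tail_conv.sub_const 1
  norm_num at h
  refine h.congr fun k => ?_
  rw [tail_conv hp.hasSum.summable hp.hasSum.summable, hp.hasSum.tsum_eq, add_div, one_mul,
    div_self (hp.tail_pos k).ne', add_sub_cancel_right]

/-- A subexponential tail is long-tailed. -/
theorem tendsto_tail_div_tail_succ (hp : IsSubexponential p) :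
    Tendsto (fun k => tail p k / tail p (k + 1)) atTop (𝓝 1) := by
  have hs := hp.hasSum.summable
  have hq : 0 < 1 - p 0 := by
    have := tsum_eq_add_tail hs
    rw [hp.hasSum.tsum_eq] at this
    linarith [hp.tail_pos 0]
  have hQ : Tendsto (fun k => ∑ l ∈ Finset.range (k + 1), p (l + 1)) atTop (𝓝 (1 - p 0)) := by
    have h := (hasSum_nat_add_iff' 1).2 hp.hasSum
    rw [Finset.sum_range_one] at h
    exact h.tendsto_sum_nat.comp (tendsto_add_atTop_nat 1)
  have hup := ((((tendsto_add_atTop_iff_nat 1).2 hp.tendsto_conv_tail_self).sub_const (p 0)).div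
    hQ hq.ne')
  rw [div_self hq.ne'] at hup
  refine tendsto_of_tendsto_of_tendsto_of_le_of_le' tendsto_const_nhds hup
    (Eventually.of_forall fun k => ?_) ?_
  · rw [le_div_iff₀ (hp.tail_pos _), one_mul]
    exact tail_antitone hp.nonneg hs k.le_succ
  · filter_upwards [hQ.eventually_const_lt hq] with k hk
    have hT := hp.tail_pos (k + 1)
    simp only [Pi.div_apply]
    rw [le_div_iff₀ hk, le_sub_iff_add_le, le_div_iff₀ hT, add_mul, mul_right_comm,
      div_mul_cancel₀ _ hT.ne', conv, Finset.sum_range_succ' _ (k + 1),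
      Finset.mul_sum, mul_comm (p 0)]
    gcongr with l
    · exact hp.nonneg _
    · exact tail_antitone hp.nonneg hs (by omega)
    · exact hp.nonneg _
    · exact (congrArg (tail p) (Nat.sub_zero _)).ge

theorem tendsto_tail_div_tail_add (hp : IsSubexponential p) (j : ℕ) :
    Tendsto (fun k => tail p k / tail p (k + j)) atTop (𝓝 1) := by
  induction j with
  | zero => simp [div_self (hp.tail_pos _).ne']
  | succ j ih =>
    have h := ih.mul ((tendsto_add_atTop_iff_nat j).2 hp.tendsto_tail_div_tail_succ)
    rw [one_mul] at h
    refine h.congr fun k => ?_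
    rw [div_mul_div_cancel₀ (hp.tail_pos _).ne', add_assoc]

theorem tendsto_div_tail_add (hp : IsSubexponential p) {a : ℕ → ℝ} {α : ℝ} (hs : Summable a)
    (hα : Tendsto (fun k => tail a k / tail p k) atTop (𝓝 α)) (j : ℕ) :
    Tendsto (fun k => a k / tail p (k + j)) atTop (𝓝 0) := by
  have h0 : Tendsto (fun k => a k / tail p k) atTop (𝓝 0) := by
    rw [← tendsto_add_atTop_iff_nat 1]
    have h := (hα.mul hp.tendsto_tail_div_tail_succ).sub ((tendsto_add_atTop_iff_nat 1).2 hα)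
    rw [mul_one, sub_self] at h
    refine h.congr fun k => ?_
    rw [div_mul_div_cancel₀ (hp.tail_pos _).ne', ← sub_div, tail_eq_add_tail_succ hs k,
      add_sub_cancel_right]
  have h := h0.mul (hp.tendsto_tail_div_tail_add j)
  rw [zero_mul] at h
  exact h.congr fun k => div_mul_div_cancel₀ (hp.tail_pos _).ne'

theorem tendsto_conv_tail_div (hp : IsSubexponential p) {a : ℕ → ℝ} {α : ℝ} (hs : Summable a)
    (hα : Tendsto (fun k => tail a k / tail p k) atTop (𝓝 α)) :
    Tendsto (fun k => conv (tail p) a k / tail p k) atTop (𝓝 (∑' k, a k)) := by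
  have hps := hp.hasSum.summable
  have h1 : Tendsto (fun k => tail p k / tail p k) atTop (𝓝 1) := by
    simp [div_self (hp.tail_pos _).ne']
  have h := tendsto_conv_div_of_tendsto_div hp.tail_pos hp.nonneg
    (hp.tendsto_div_tail_add hps h1) hp.tendsto_conv_tail_self hα
  have h2 := (h.add_const (∑' k, a k)).sub hα
  rw [mul_one, add_sub_cancel_left] at h2
  refine h2.congr fun k => ?_
  have e1 := tail_conv hps hs k
  have e2 := tail_conv hs hps k
  rw [show conv a p = conv p a from funext (conv_comm a p), e1, hp.hasSum.tsum_eq] at e2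
  have hT := (hp.tail_pos k).ne'
  field_simp
  linarith

/-- Convolution asymptotics: only the total mass of `a` matters against `g ∼ γ P(Y > ·)`. -/
theorem tendsto_conv_div (hp : IsSubexponential p) {a g : ℕ → ℝ} {α γ : ℝ}
    (ha : ∀ k, 0 ≤ a k) (hs : Summable a)
    (hα : Tendsto (fun k => tail a k / tail p k) atTop (𝓝 α))
    (hg : Tendsto (fun k => g k / tail p k) atTop (𝓝 γ)) :
    Tendsto (fun k => conv g a k / tail p k) atTop (𝓝 (γ * ∑' k, a k)) :=
  tendsto_conv_div_of_tendsto_div hp.tail_pos ha (hp.tendsto_div_tail_add hs hα)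
    (hp.tendsto_conv_tail_div hs hα) hg

end IsSubexponential

namespace IsSubexponential

variable {p : ℕ → ℝ} {ι : Type*} [Fintype ι] {a : ι → ι → ℕ → ℝ} {α : ι → ι → ℝ}
  {w : ι → ℝ} {ρ : ℝ} {D e : ι → ℕ → ℝ}

/-- A solution of a strictly subcritical renewal inequality with forcing term `o(P(Y > k))`
is `O(P(Y > k))`. -/
theorem exists_abs_le_of_renewal (hp : IsSubexponential p)
    (ha : ∀ m j k, 0 ≤ a m j k) (hs : ∀ m j, Summable (a m j))
    (hα : ∀ m j, Tendsto (fun k => tail (a m j) k / tail p k) atTop (𝓝 (α m j)))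
    (hw : ∀ m, 0 < w m) (hρ1 : ρ < 1) (hwρ : ∀ j, ∑ m, w m * ∑' k, a m j k ≤ ρ * w j)
    (he : ∀ j, Tendsto (fun k => e j k / tail p k) atTop (𝓝 0))
    (hD : ∀ j k, |D j k| ≤ ∑ m, conv (fun n => |D m n|) (a m j) k + e j k) :
    ∃ A, 0 ≤ A ∧ ∀ k m, |D m k| ≤ A * w m * tail p k := by
  obtain ⟨r, hρr, hr1⟩ := exists_between hρ1
  have hev : ∀ᶠ k in atTop, ∀ j, ∑ m, w m * (conv (tail p) (a m j) k / tail p k) < r * w j ∧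
      e j k / tail p k < (1 - r) * w j := by
    rw [eventually_all]
    intro j
    have h1 : Tendsto (fun k => ∑ m, w m * (conv (tail p) (a m j) k / tail p k)) atTop
        (𝓝 (∑ m, w m * ∑' k, a m j k)) :=
      tendsto_finsetSum _ fun m _ => (hp.tendsto_conv_tail_div (hs m j) (hα m j)).const_mul _
    exact (h1.eventually_lt_const ((hwρ j).trans_lt (mul_lt_mul_of_pos_right hρr (hw j)))).and
      ((he j).eventually_lt_const (mul_pos (sub_pos.2 hr1) (hw j)))
  obtain ⟨k₀, hk₀⟩ := eventually_atTop.1 hev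
  have hpos : ∀ m k, 0 < w m * tail p k := fun m k => mul_pos (hw m) (hp.tail_pos k)
  have hq : ∀ k m, 0 ≤ |D m k| / (w m * tail p k) := fun k m =>
    div_nonneg (abs_nonneg _) (hpos m k).le
  set A : ℝ := 1 + ∑ k ∈ Finset.range k₀, ∑ m, |D m k| / (w m * tail p k) with hA
  have hA1 : 1 ≤ A :=
    le_add_of_nonneg_right (Finset.sum_nonneg fun k _ => Finset.sum_nonneg fun m _ => hq k m)
  refine ⟨A, by linarith, fun k => ?_⟩
  induction k using Nat.strong_induction_on with
  | _ k ih =>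
  intro m
  rw [mul_assoc, ← div_le_iff₀ (hpos m k)]
  rcases lt_or_ge k k₀ with hk | hk
  · have h1 := Finset.single_le_sum (fun m _ => hq k m) (Finset.mem_univ m)
    have h2 := Finset.single_le_sum (f := fun k => ∑ m, |D m k| / (w m * tail p k))
      (fun k _ => Finset.sum_nonneg fun m _ => hq k m) (Finset.mem_range.2 hk)
    linarith
  · have : Nonempty ι := ⟨m⟩
    obtain ⟨j, hj⟩ := Finite.exists_max fun m => |D m k| / (w m * tail p k)
    refine (hj m).trans ?_
    by_contra! hlt
    set B := |D j k| / (w j * tail p k) with hB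
    have hle : ∀ m, ∀ n ≤ k, |D m n| ≤ B * w m * tail p n := by
      intro m n hn
      rcases hn.lt_or_eq with hn | rfl
      · refine (ih n hn m).trans ?_
        rw [mul_assoc, mul_assoc]
        exact mul_le_mul_of_nonneg_right hlt.le (hpos m n).le
      · rw [mul_assoc, ← div_le_iff₀ (hpos m n)]
        exact hj m
    have hT := hp.tail_pos k
    have h1 : ∑ m, conv (fun n => |D m n|) (a m j) k ≤
        B * (∑ m, w m * (conv (tail p) (a m j) k / tail p k)) * tail p k := by
      rw [Finset.mul_sum, Finset.sum_mul]
      refine Finset.sum_le_sum fun m _ => (conv_mono (ha m j) (hle m)).trans_eq ?_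
      rw [conv_const_mul]
      field_simp
    obtain ⟨hk1, hk2⟩ := hk₀ k hk j
    rw [div_lt_iff₀ hT] at hk2
    have hB0 : 0 < B := by linarith
    have h2 : B * (w j * tail p k) = |D j k| := div_mul_cancel₀ _ (hpos j k).ne'
    have h3 := mul_le_mul_of_nonneg_right (mul_le_mul_of_nonneg_left hk1.le hB0.le) hT.le
    have h4 : (B * (1 - r)) * (w j * tail p k) < (1 - r) * (w j * tail p k) := by
      linarith [hD j k]
    have h5 := lt_of_mul_lt_mul_right h4 (hpos j k).le
    nlinarith

/-- A solution of a strictly subcritical renewal inequality with forcing term `o(P(Y > k))`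
is `o(P(Y > k))`. -/
theorem tendsto_div_tail_of_renewal (hp : IsSubexponential p)
    (ha : ∀ m j k, 0 ≤ a m j k) (hs : ∀ m j, Summable (a m j))
    (hα : ∀ m j, Tendsto (fun k => tail (a m j) k / tail p k) atTop (𝓝 (α m j)))
    (hw : ∀ m, 0 < w m) (hρ0 : 0 ≤ ρ) (hρ1 : ρ < 1)
    (hwρ : ∀ j, ∑ m, w m * ∑' k, a m j k ≤ ρ * w j)
    (he : ∀ j, Tendsto (fun k => e j k / tail p k) atTop (𝓝 0))
    (hD : ∀ j k, |D j k| ≤ ∑ m, conv (fun n => |D m n|) (a m j) k + e j k) (j : ι) :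
    Tendsto (fun k => D j k / tail p k) atTop (𝓝 0) := by
  set S : Set ℝ := {A | 0 ≤ A ∧ ∀ᶠ k in atTop, ∀ m, |D m k| ≤ A * w m * tail p k} with hS
  have hSne : S.Nonempty := by
    obtain ⟨A, hA0, hA⟩ := hp.exists_abs_le_of_renewal ha hs hα hw hρ1 hwρ he hD
    exact ⟨A, hA0, Eventually.of_forall hA⟩
  have hSbdd : BddBelow S := ⟨0, fun A hA => hA.1⟩
  have himp : ∀ A ∈ S, ∀ ε > 0, ρ * A + ε ∈ S := by
    rintro A ⟨hA0, hA⟩ ε hε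
    refine ⟨by positivity, ?_⟩
    rw [eventually_all]
    intro j
    set g : ι → ℕ → ℝ := fun m k => max |D m k| (A * w m * tail p k) with hg
    have hgT : ∀ m, Tendsto (fun k => g m k / tail p k) atTop (𝓝 (A * w m)) := by
      intro m
      refine tendsto_const_nhds.congr' ?_
      filter_upwards [hA] with k hk
      rw [hg]
      simp only [max_eq_right (hk m)]
      rw [mul_div_cancel_right₀ _ (hp.tail_pos k).ne']
    have hlim : Tendsto (fun k => ∑ m, conv (g m) (a m j) k / tail p k + e j k / tail p k) atTop
        (𝓝 (∑ m, A * w m * (∑' k, a m j k) + 0)) :=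
      (tendsto_finsetSum _ fun m _ =>
        hp.tendsto_conv_div (ha m j) (hs m j) (hα m j) (hgT m)).add (he j)
    have hlt : ∑ m, A * w m * (∑' k, a m j k) + 0 < (ρ * A + ε) * w j := by
      have h1 := mul_le_mul_of_nonneg_left (hwρ j) hA0
      rw [Finset.mul_sum] at h1
      simp only [mul_assoc] at h1 ⊢
      nlinarith [mul_pos hε (hw j)]
    filter_upwards [hlim.eventually_lt_const hlt] with k hk
    rw [← Finset.sum_div, ← add_div, div_lt_iff₀ (hp.tail_pos k)] at hk
    refine (hD j k).trans (le_trans ?_ hk.le)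
    gcongr with m
    exact conv_mono (ha m j) fun n _ => le_max_left _ _
  have hs0 : sInf S ≤ 0 := by
    have h : sInf S ≤ ρ * sInf S := by
      refine le_of_forall_pos_le_add fun ε hε => ?_
      obtain ⟨A, hAS, hA⟩ := exists_lt_of_csInf_lt hSne (lt_add_of_pos_right (sInf S) (half_pos hε))
      have h1 := csInf_le hSbdd (himp A hAS (ε / 2) (half_pos hε))
      nlinarith
    nlinarith
  rw [Metric.tendsto_nhds]
  intro ε hε
  obtain ⟨A, ⟨hA0, hA⟩, hAε⟩ := exists_lt_of_csInf_lt hSne (hs0.trans_lt (div_pos hε (hw j)))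
  filter_upwards [hA] with k hk
  have hT := hp.tail_pos k
  rw [lt_div_iff₀ (hw j)] at hAε
  rw [Real.dist_eq, sub_zero, abs_div, abs_of_pos hT, div_lt_iff₀ hT]
  exact (hk j).trans_lt (mul_lt_mul_of_pos_right hAε hT)

end IsSubexponential

/-! ### Matrices of spectral radius less than one -/

section NeumannSeries

attribute [local instance] Matrix.linftyOpNormedRing Matrix.linftyOpNormedAlgebra

theorem summable_norm_pow_of_spectralRadius_lt_one {A : Type*} [NormedRing A] [NormedAlgebra ℂ A]
    [CompleteSpace A] {a : A} (h : spectralRadius ℂ a < 1) : Summable fun n => ‖a ^ n‖ := by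
  obtain ⟨r, hr, hr1⟩ := ENNReal.lt_iff_exists_nnreal_btwn.1 h
  have hr1 : r < 1 := by exact_mod_cast hr1
  have hev := (spectrum.pow_nnnorm_pow_one_div_tendsto_nhds_spectralRadius a).eventually_lt_const hr
  refine Summable.of_norm_bounded_eventually_nat
    (summable_geometric_of_lt_one r.coe_nonneg (by exact_mod_cast hr1)) ?_
  filter_upwards [hev, eventually_gt_atTop 0] with n hn hn0
  have hn0' : (0 : ℝ) < n := by exact_mod_cast hn0
  rw [one_div, ENNReal.rpow_inv_lt_iff hn0', ENNReal.rpow_natCast] at hn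
  rw [norm_norm]
  exact_mod_cast hn.le

theorem Matrix.summable_pow_of_spectrum_lt_one {M : ℕ} {A : Matrix (Fin M) (Fin M) ℝ}
    (h : ∀ μ ∈ spectrum ℂ (A.map Complex.ofReal), ‖μ‖ < 1) (i j : Fin M) :
    Summable fun n => (A ^ n) i j := by
  have : Nonempty (Fin M) := ⟨i⟩
  have hr : spectralRadius ℂ (A.map Complex.ofReal) < 1 :=
    spectrum.spectralRadius_lt_of_forall_lt (r := 1) _ fun μ hμ => by exact_mod_cast h μ hμ
  have hs := (summable_norm_pow_of_spectralRadius_lt_one hr).of_norm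
  have hij := (Pi.summable.1 (Pi.summable.1 hs i)) j
  rw [← Complex.summable_ofReal]
  refine hij.congr fun n => ?_
  have := Matrix.map_pow A Complex.ofRealHom n
  exact (congrFun (congrFun this i) j).symm

end NeumannSeries

/-! ### Convolution powers of matrix sequences -/

section ConvolutionPowers

variable {M : ℕ} {R : ℕ → Matrix (Fin M) (Fin M) ℝ}

theorem mconv_apply {d0 d1 d2 : ℕ} (P : ℕ → Matrix (Fin d0) (Fin d1) ℝ)
    (Q : ℕ → Matrix (Fin d1) (Fin d2) ℝ) (k : ℕ) (i : Fin d0) (j : Fin d2) :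
    mconv P Q k i j = ∑ m, conv (fun n => P n i m) (fun n => Q n m j) k := by
  simp only [mconv, conv, Matrix.sum_apply, Matrix.mul_apply]
  exact Finset.sum_comm

theorem mconvPow_succ_apply (R : ℕ → Matrix (Fin M) (Fin M) ℝ) (n k : ℕ) (i j : Fin M) :
    mconvPow R (n + 1) k i j =
      ∑ m, conv (fun l => mconvPow R n l i m) (fun l => R l m j) k :=
  mconv_apply (mconvPow R n) R k i j

theorem mconvPow_nonneg (hR : ∀ k i j, 0 ≤ R k i j) (n k : ℕ) (i j : Fin M) :
    0 ≤ mconvPow R n k i j := by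
  induction n generalizing k i j with
  | zero =>
    simp only [mconvPow]
    split_ifs
    · rw [Matrix.one_apply]
      split_ifs <;> norm_num
    · exact le_rfl
  | succ n ih =>
    rw [mconvPow_succ_apply]
    exact Finset.sum_nonneg fun m _ => Finset.sum_nonneg fun l _ => mul_nonneg (ih _ _ _) (hR _ _ _)

theorem hasSum_mconvPow {Rs : Matrix (Fin M) (Fin M) ℝ}
    (hRs : ∀ i j, HasSum (fun k => R k i j) (Rs i j)) (n : ℕ) (i j : Fin M) :
    HasSum (fun k => mconvPow R n k i j) ((Rs ^ n) i j) := by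
  induction n generalizing i j with
  | zero =>
    have h := hasSum_ite_eq (0 : ℕ) ((1 : Matrix (Fin M) (Fin M) ℝ) i j)
    rw [pow_zero]
    convert! h using 2 with k
    simp only [mconvPow]
    split_ifs <;> rfl
  | succ n ih =>
    rw [pow_succ, Matrix.mul_apply]
    simp only [mconvPow_succ_apply]
    refine hasSum_sum fun m _ => ?_
    have h := hasSum_conv (ih i m).summable (hRs m j).summable
    rwa [(ih i m).tsum_eq, (hRs m j).tsum_eq] at h

theorem summable_mconvPow_prod (hR : ∀ k i j, 0 ≤ R k i j) {Rs : Matrix (Fin M) (Fin M) ℝ}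
    (hRs : ∀ i j, HasSum (fun k => R k i j) (Rs i j))
    (hpow : ∀ i j, Summable fun n => (Rs ^ n) i j) (i j : Fin M) :
    Summable fun x : ℕ × ℕ => mconvPow R x.1 x.2 i j := by
  rw [summable_prod_of_nonneg fun x => mconvPow_nonneg hR _ _ _ _]
  refine ⟨fun n => (hasSum_mconvPow hRs n i j).summable, ?_⟩
  exact (hpow i j).congr fun n => (hasSum_mconvPow hRs n i j).tsum_eq.symm

theorem hasSum_tsum_mconvPow (hR : ∀ k i j, 0 ≤ R k i j) {Rs : Matrix (Fin M) (Fin M) ℝ}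
    (hRs : ∀ i j, HasSum (fun k => R k i j) (Rs i j))
    (hpow : ∀ i j, Summable fun n => (Rs ^ n) i j) (i j : Fin M) :
    HasSum (fun k => ∑' n, mconvPow R n k i j) (∑' n, (Rs ^ n) i j) := by
  have hs := summable_mconvPow_prod hR hRs hpow i j
  have h1 := hs.hasSum.prod_fiberwise fun n => hasSum_mconvPow hRs n i j
  rw [h1.tsum_eq]
  rw [← (Equiv.prodComm ℕ ℕ).tsum_eq fun x : ℕ × ℕ => mconvPow R x.1 x.2 i j]
  exact hs.prod_symm.hasSum.prod_fiberwise fun k => (hs.prod_symm.prod_factor k).hasSum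

/-- The renewal equation for the sum of all convolution powers. -/
theorem tsum_mconvPow_eq (hR : ∀ k i j, 0 ≤ R k i j) {Rs : Matrix (Fin M) (Fin M) ℝ}
    (hRs : ∀ i j, HasSum (fun k => R k i j) (Rs i j))
    (hpow : ∀ i j, Summable fun n => (Rs ^ n) i j) (k : ℕ) (i j : Fin M) :
    ∑' n, mconvPow R n k i j = (if k = 0 then (1 : Matrix (Fin M) (Fin M) ℝ) else 0) i j +
      ∑ m, conv (fun l => ∑' n, mconvPow R n l i m) (fun l => R l m j) k := by
  have hs : ∀ l m, Summable fun n => mconvPow R n l i m := fun l m =>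
    (summable_mconvPow_prod hR hRs hpow i m).prod_symm.prod_factor l
  rw [(hs k j).tsum_eq_zero_add]
  congr 1
  simp only [mconvPow_succ_apply, conv]
  rw [Summable.tsum_finsetSum fun m _ => summable_sum fun l _ => (hs _ m).mul_right _]
  refine Finset.sum_congr rfl fun m _ => ?_
  rw [Summable.tsum_finsetSum fun l _ => (hs _ m).mul_right _]
  exact Finset.sum_congr rfl fun l _ => tsum_mul_right

theorem Matrix.inv_one_sub_eq_tsum_pow {A : Matrix (Fin M) (Fin M) ℝ}
    (hpow : ∀ i j, Summable fun n => (A ^ n) i j) :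
    (1 - A)⁻¹ = Matrix.of fun i j => ∑' n, (A ^ n) i j := by
  have hs : Summable fun n => A ^ n := Pi.summable.2 fun i => Pi.summable.2 fun j => hpow i j
  have h : ∑' n, A ^ n = Matrix.of fun i j => ∑' n, (A ^ n) i j := by
    ext i j
    have hi := Pi.hasSum.1 (Pi.hasSum.1 hs.hasSum i) j
    exact hi.tsum_eq.symm
  rw [← h]
  exact Matrix.inv_eq_left_inv hs.tsum_pow_mul_one_sub

/-- A nonnegative matrix with summable powers has a strictly subinvariant positive row vector. -/
theorem exists_pos_subinvariant {A : Matrix (Fin M) (Fin M) ℝ} (hA : ∀ i j, 0 ≤ A i j)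
    (hpow : ∀ i j, Summable fun n => (A ^ n) i j) :
    ∃ (w : Fin M → ℝ) (ρ : ℝ), (∀ m, 0 < w m) ∧ 0 ≤ ρ ∧ ρ < 1 ∧
      ∀ j, ∑ m, w m * A m j ≤ ρ * w j := by
  set S : Matrix (Fin M) (Fin M) ℝ := Matrix.of fun i j => ∑' n, (A ^ n) i j with hS
  have hnn : ∀ n i j, 0 ≤ (A ^ n) i j := by
    intro n
    induction n with
    | zero => intro i j; rw [pow_zero, Matrix.one_apply]; split_ifs <;> norm_num
    | succ n ih =>
      intro i j
      rw [pow_succ, Matrix.mul_apply]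
      exact Finset.sum_nonneg fun m _ => mul_nonneg (ih _ _) (hA _ _)
  have hSA : ∀ i j, S i j = (1 : Matrix (Fin M) (Fin M) ℝ) i j + ∑ m, S i m * A m j := by
    intro i j
    simp only [hS, Matrix.of_apply]
    rw [(hpow i j).tsum_eq_zero_add, pow_zero]
    simp only [pow_succ, Matrix.mul_apply]
    rw [Summable.tsum_finsetSum fun m _ => (hpow i m).mul_right _]
    simp only [tsum_mul_right]
  have hS0 : ∀ i j, 0 ≤ S i j := fun i j => tsum_nonneg fun n => hnn n i j
  set w : Fin M → ℝ := fun j => ∑ i, S i j with hw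
  have hwA : ∀ j, w j = 1 + ∑ m, w m * A m j := by
    intro j
    simp only [hw, Finset.sum_mul]
    rw [Finset.sum_comm, Finset.sum_congr rfl fun i _ => hSA i j, Finset.sum_add_distrib]
    simp [Matrix.one_apply]
  have hw0 : ∀ j, 0 ≤ w j := fun j => Finset.sum_nonneg fun i _ => hS0 i j
  have hw1 : ∀ j, 1 ≤ w j := fun j => by
    rw [hwA j]
    exact le_add_of_nonneg_right (Finset.sum_nonneg fun m _ => mul_nonneg (hw0 m) (hA m j))
  set W : ℝ := 1 + ∑ m, w m with hW
  have hW1 : 1 ≤ W := le_add_of_nonneg_right (Finset.sum_nonneg fun m _ => hw0 m)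
  have hW0 : 0 < W := by linarith
  refine ⟨w, 1 - W⁻¹, fun m => by linarith [hw1 m], sub_nonneg.2 (inv_le_one_of_one_le₀ hW1),
    sub_lt_self _ (inv_pos.2 hW0), fun j => ?_⟩
  have hle : W⁻¹ * w j ≤ 1 := by
    rw [inv_mul_le_iff₀ hW0, mul_one, hW]
    linarith [Finset.single_le_sum (fun m _ => hw0 m) (Finset.mem_univ j)]
  linarith [hwA j]

end ConvolutionPowers

/-- Tail asymptotics of the sum of all convolution powers of `R`. -/
theorem IsSubexponential.tendsto_tail_tsum_mconvPow {p : ℕ → ℝ} (hp : IsSubexponential p) {M : ℕ}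
    {R : ℕ → Matrix (Fin M) (Fin M) ℝ} (hR : ∀ k i j, 0 ≤ R k i j)
    {Rs : Matrix (Fin M) (Fin M) ℝ} (hRs : ∀ i j, HasSum (fun k => R k i j) (Rs i j))
    (hpow : ∀ i j, Summable fun n => (Rs ^ n) i j) {CR : Matrix (Fin M) (Fin M) ℝ}
    (hCR : ∀ i j, Tendsto (fun k => tail (fun n => R n i j) k / tail p k) atTop (𝓝 (CR i j)))
    (i j : Fin M) :
    Tendsto (fun k => tail (fun l => ∑' n, mconvPow R n l i j) k / tail p k) atTop
      (𝓝 (((1 - Rs)⁻¹ * CR * (1 - Rs)⁻¹) i j)) := by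
  set S : Matrix (Fin M) (Fin M) ℝ := (1 - Rs)⁻¹ with hS
  set L : Matrix (Fin M) (Fin M) ℝ := S * CR * S with hL
  set f : Fin M → ℕ → ℝ := fun j l => ∑' n, mconvPow R n l i j with hf
  have hSof := Matrix.inv_one_sub_eq_tsum_pow hpow
  have hfS : ∀ j, HasSum (f j) (S i j) := fun j => by
    rw [hS, hSof]
    exact hasSum_tsum_mconvPow hR hRs hpow i j
  have hS1 : S * (1 - Rs) = 1 := by
    have hs : Summable fun n => Rs ^ n := Pi.summable.2 fun i => Pi.summable.2 fun j => hpow i j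
    exact Matrix.nonsing_inv_mul _
      (Matrix.isUnit_det_of_left_inverse hs.tsum_pow_mul_one_sub)
  have hLeq : L * Rs + S * CR = L := by
    have h : L * (1 - Rs) = S * CR := by rw [hL, Matrix.mul_assoc, hS1, Matrix.mul_one]
    rw [← h, Matrix.mul_sub, Matrix.mul_one, add_sub_cancel]
  have hren : ∀ j k, tail (f j) k =
      ∑ m, (conv (tail (f m)) (fun n => R n m j) k + S i m * tail (fun n => R n m j) k) := by
    intro j k
    have hsum : ∀ m, Summable (conv (f m) fun n => R n m j) := fun m =>
      (hasSum_conv (hfS m).summable (hRs m j).summable).summable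
    have h1 : tail (f j) k = tail (fun l => ∑ m, conv (f m) (fun n => R n m j) l) k := by
      refine tsum_congr fun l => ?_
      rw [hf]
      simp only [tsum_mconvPow_eq hR hRs hpow (k + 1 + l) i j]
      rw [if_neg (by omega), Matrix.zero_apply, zero_add]
    rw [h1, tail_sum _ fun m _ => hsum m]
    refine Finset.sum_congr rfl fun m _ => ?_
    rw [tail_conv (hfS m).summable (hRs m j).summable, (hfS m).tsum_eq]
  set D : Fin M → ℕ → ℝ := fun j k => tail (f j) k - L i j * tail p k with hD
  set E : Fin M → ℕ → ℝ := fun j k =>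
    ∑ m, (L i m * conv (tail p) (fun n => R n m j) k + S i m * tail (fun n => R n m j) k) -
      L i j * tail p k with hE
  have hDE : ∀ j k, D j k = ∑ m, conv (D m) (fun n => R n m j) k + E j k := by
    intro j k
    simp only [hD, hE, hren j k, conv_sub, conv_const_mul, Finset.sum_sub_distrib,
      Finset.sum_add_distrib]
    ring
  have hET : ∀ j, Tendsto (fun k => E j k / tail p k) atTop (𝓝 0) := by
    intro j
    have h : Tendsto (fun k => ∑ m, (L i m * (conv (tail p) (fun n => R n m j) k / tail p k) +
        S i m * (tail (fun n => R n m j) k / tail p k)) - L i j) atTop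
        (𝓝 (∑ m, (L i m * Rs m j + S i m * CR m j) - L i j)) := by
      refine (tendsto_finsetSum _ fun m _ => Tendsto.add ?_ ((hCR m j).const_mul _)).sub_const _
      have := hp.tendsto_conv_tail_div (hRs m j).summable (hCR m j)
      rw [(hRs m j).tsum_eq] at this
      exact this.const_mul _
    have h0 : ∑ m, (L i m * Rs m j + S i m * CR m j) - L i j = 0 := by
      rw [Finset.sum_add_distrib, ← Matrix.mul_apply, ← Matrix.mul_apply, ← Matrix.add_apply, hLeq,
        sub_self]
    rw [h0] at h
    refine h.congr fun k => ?_
    rw [hE]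
    simp only [sub_div, Finset.sum_div, add_div, mul_div_assoc, div_self (hp.tail_pos k).ne',
      mul_one]
  have hRs0 : ∀ i j, 0 ≤ Rs i j := fun i j => (hRs i j).nonneg fun k => hR k i j
  obtain ⟨w, ρ, hw, hρ0, hρ1, hwρ⟩ := exists_pos_subinvariant hRs0 hpow
  have hDT := hp.tendsto_div_tail_of_renewal (a := fun m j n => R n m j) (D := D)
    (e := fun j k => |E j k|) (fun m j k => hR k m j) (fun m j => (hRs m j).summable) hCR hw hρ0 hρ1
    (fun j => by simpa only [(hRs _ j).tsum_eq] using hwρ j)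
    (fun j => by
      have := (hET j).abs
      rw [abs_zero] at this
      exact this.congr fun k => by rw [abs_div, abs_of_pos (hp.tail_pos k)])
    (fun j k => by
      rw [hDE j k]
      refine (abs_add_le _ _).trans (add_le_add_left ?_ _)
      exact (Finset.abs_sum_le_sum_abs _ _).trans
        (Finset.sum_le_sum fun m _ => abs_conv_le (fun n => hR n m j) k)) j
  have h := hDT.add_const (L i j)
  rw [zero_add] at h
  refine h.congr fun k => ?_
  rw [hD]
  have hT := (hp.tail_pos k).ne'
  field_simp
  ring

/-- Subexponential tail asymptotics of `x(k) = x(0) (R₀ * F)(k)`,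
`F = Σ_n R^{*n}` (skeleton of Theorems 3.1–3.2 of the paper). -/
theorem stmt17 (M0 M : ℕ)
    (p : ℕ → ℝ) (hpnn : ∀ k, 0 ≤ p k) (hpsum : HasSum p 1)
    (htpos : ∀ k, 0 < tail p k)
    (hsubexp : Tendsto (fun k => (∑' j : ℕ, conv p p (k + 1 + j)) / tail p k)
      atTop (nhds 2))
    (R0 : ℕ → Matrix (Fin M0) (Fin M) ℝ) (R : ℕ → Matrix (Fin M) (Fin M) ℝ)
    (hR0nn : ∀ k i j, 0 ≤ R0 k i j) (hRnn : ∀ k i j, 0 ≤ R k i j)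
    (hR0sum : ∀ i j, Summable fun k => R0 k i j)
    (hRsum : ∀ i j, Summable fun k => R k i j)
    (Rs : Matrix (Fin M) (Fin M) ℝ) (hRs : Rs = Matrix.of fun i j => ∑' k, R k i j)
    (R0s : Matrix (Fin M0) (Fin M) ℝ)
    (hR0s : R0s = Matrix.of fun i j => ∑' k, R0 k i j)
    (hspR : ∀ μ ∈ spectrum ℂ (Rs.map (Complex.ofReal)), ‖μ‖ < 1)
    (CR0 : Matrix (Fin M0) (Fin M) ℝ) (CR : Matrix (Fin M) (Fin M) ℝ)
    (hCR0 : ∀ i j, Tendsto (fun k => (∑' l : ℕ, R0 (k + 1 + l) i j) / tail p k)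
      atTop (nhds (CR0 i j)))
    (hCR : ∀ i j, Tendsto (fun k => (∑' l : ℕ, R (k + 1 + l) i j) / tail p k)
      atTop (nhds (CR i j)))
    (x0 : Fin M0 → ℝ)
    (F : ℕ → Matrix (Fin M) (Fin M) ℝ)
    (hF : ∀ k, F k = Matrix.of fun i j => ∑' n : ℕ, mconvPow R n k i j)
    (x : ℕ → Fin M → ℝ)
    (hx : ∀ k : ℕ, x (k + 1) = Matrix.vecMul x0 (mconv R0 F (k + 1))) :
    ∀ j, Tendsto (fun k => (∑' l : ℕ, x (k + 1 + l) j) / tail p k) atTop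
      (nhds (Matrix.vecMul x0
        (CR0 * (1 - Rs)⁻¹ + R0s * (1 - Rs)⁻¹ * CR * (1 - Rs)⁻¹) j)) := by
  have hp : IsSubexponential p := ⟨hpnn, hpsum, htpos, hsubexp⟩
  have hRs' : ∀ i j, HasSum (fun k => R k i j) (Rs i j) := fun i j => by
    rw [hRs]
    exact (hRsum i j).hasSum
  have hpow := Matrix.summable_pow_of_spectrum_lt_one hspR
  set S : Matrix (Fin M) (Fin M) ℝ := (1 - Rs)⁻¹ with hS
  have hFS : ∀ m j, HasSum (fun k => F k m j) (S m j) := fun m j => by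
    rw [hS, Matrix.inv_one_sub_eq_tsum_pow hpow]
    simp only [hF]
    exact hasSum_tsum_mconvPow hRnn hRs' hpow m j
  have hFT : ∀ m j, Tendsto (fun k => tail (fun l => F l m j) k / tail p k) atTop
      (𝓝 ((S * CR * S) m j)) := fun m j => by
    simp only [hF]
    exact hp.tendsto_tail_tsum_mconvPow hRnn hRs' hpow hCR m j
  intro j
  have hsum : ∀ i m, Summable (conv (fun n => R0 n i m) fun n => F n m j) := fun i m =>
    (hasSum_conv (hR0sum i m) (hFS m j).summable).summable
  have htail : ∀ k, ∑' l, x (k + 1 + l) j = ∑ i, x0 i *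
      ∑ m, (conv (tail fun n => F n m j) (fun n => R0 n i m) k +
        S m j * tail (fun n => R0 n i m) k) := by
    intro k
    have h1 : ∑' l, x (k + 1 + l) j = tail (fun n => ∑ i, x0 i *
        ∑ m, conv (fun n => R0 n i m) (fun n => F n m j) n) k := by
      refine tsum_congr fun l => ?_
      rw [show k + 1 + l = k + l + 1 by omega, hx]
      simp only [Matrix.vecMul, dotProduct, mconv_apply]
    rw [h1, tail_sum _ fun i _ => (summable_sum fun m _ => hsum i m).mul_left _]
    refine Finset.sum_congr rfl fun i _ => ?_
    rw [tail_const_mul, tail_sum _ fun m _ => hsum i m]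
    congr 1
    refine Finset.sum_congr rfl fun m _ => ?_
    rw [show (conv (fun n => R0 n i m) fun n => F n m j) =
      conv (fun n => F n m j) fun n => R0 n i m from funext (conv_comm _ _),
      tail_conv (hFS m j).summable (hR0sum i m), (hFS m j).tsum_eq]
  have hlim : Tendsto (fun k => ∑ i, x0 i *
      ∑ m, (conv (tail fun n => F n m j) (fun n => R0 n i m) k / tail p k +
        S m j * (tail (fun n => R0 n i m) k / tail p k))) atTop
      (𝓝 (∑ i, x0 i * ∑ m, ((S * CR * S) m j * (∑' k, R0 k i m) + S m j * CR0 i m))) :=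
    tendsto_finsetSum _ fun i _ => Tendsto.const_mul _ <| tendsto_finsetSum _ fun m _ =>
      (hp.tendsto_conv_div (fun n => hR0nn n i m) (hR0sum i m) (hCR0 i m) (hFT m j)).add
        ((hCR0 i m).const_mul _)
  have hval : Matrix.vecMul x0 (CR0 * S + R0s * S * CR * S) j =
      ∑ i, x0 i * ∑ m, ((S * CR * S) m j * (∑' k, R0 k i m) + S m j * CR0 i m) := by
    rw [Matrix.mul_assoc R0s, Matrix.mul_assoc R0s]
    simp only [Matrix.vecMul, dotProduct]
    refine Finset.sum_congr rfl fun i _ => ?_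
    rw [Matrix.add_apply, Matrix.mul_apply, Matrix.mul_apply, ← Finset.sum_add_distrib, hR0s]
    congr 1
    refine Finset.sum_congr rfl fun m _ => ?_
    rw [Matrix.of_apply]
    ring
  rw [hval]
  refine hlim.congr fun k => ?_
  rw [htail k]
  simp only [Finset.sum_div, mul_div_assoc, add_div]
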